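/- Peetre-type maximal estimate pointwise bound iterated: for any r⃗ ∈ (0,∞)ⁿ there is c > 0 such that for every b⃗ ∈ (0,∞)ⁿ and every f ∈ S′ with supp(f̂) ⊂ [-b₁,b₁]×⋯×[-bₙ,bₙ] and f a (bounded, slowly growing) function, sup_{z∈ℝⁿ} |f(x−z)| / ∏_{k=1}^n (1+|b_k z_k|)^{1/r_k} ≤ c 𝓜_{r⃗} f(x) for all x ∈ ℝⁿ. -/

import Mathlib

open MeasureTheory Real Set
open scoped ENNReal NNReal BigOperators SchwartzMap

noncomputable section

/-- Anisotropic dilation: `(adil a l x) i = l ^ (a i) * x i`. -/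
def adil {n : ℕ} (a : Fin n → ℝ) (l : ℝ) (x : Fin n → ℝ) : Fin n → ℝ :=
  fun i => l ^ (a i) * x i

/-- Euclidean norm on `Fin n → ℝ`. -/
def enorm2 {n : ℕ} (x : Fin n → ℝ) : ℝ := Real.sqrt (∑ i, (x i) ^ 2)

/-- Anisotropic quasi-homogeneous norm. -/
def anorm {n : ℕ} (a : Fin n → ℝ) (x : Fin n → ℝ) : ℝ :=
  if x = 0 then 0 else sInf {l : ℝ | 0 < l ∧ enorm2 (adil a l⁻¹ x) = 1}

/-- One–dimensional `L^p` norm (`ℝ≥0∞`-valued). -/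
def lpnorm1 (p : ℝ≥0∞) (g : ℝ → ℝ≥0∞) : ℝ≥0∞ :=
  if p = ∞ then essSup g volume
  else (∫⁻ t, (g t) ^ p.toReal) ^ (1 / p.toReal)

/-- Mixed Lebesgue norm: iterated `L^{p₁},…,L^{pₙ}` norm, innermost variable first. -/
def mixedNorm : {n : ℕ} → (Fin n → ℝ≥0∞) → ((Fin n → ℝ) → ℝ≥0∞) → ℝ≥0∞
  | 0, _, f => f (fun i => i.elim0)
  | (_ + 1), p, f =>
      mixedNorm (fun i => p i.succ)
        (fun y => lpnorm1 (p 0) (fun t => f (Fin.cons t y)))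

/-- Mixed norm of a complex-valued function. -/
def mixedNormC {n : ℕ} (p : Fin n → ℝ≥0∞) (f : (Fin n → ℝ) → ℂ) : ℝ≥0∞ :=
  mixedNorm p (fun x => (‖f x‖₊ : ℝ≥0∞))

/-- Mixed norm of `f` restricted to a set `R`. -/
def mixedNormOn {n : ℕ} (p : Fin n → ℝ≥0∞) (R : Set (Fin n → ℝ))
    (f : (Fin n → ℝ) → ℂ) : ℝ≥0∞ :=
  mixedNorm p (R.indicator fun x => (‖f x‖₊ : ℝ≥0∞))

/-- The punctured rectangle `[-2,2]ⁿ \ (-1/2,1/2)ⁿ`. -/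
def punctRect (n : ℕ) : Set (Fin n → ℝ) :=
  {x | ∀ i, |x i| ≤ 2} \ {x | ∀ i, |x i| < 1 / 2}

/-- The anisotropic rectangles `R_j`. -/
def Rset {n : ℕ} (a : Fin n → ℝ) (j : ℕ) : Set (Fin n → ℝ) :=
  if j = 0 then adil a 2 '' {x | ∀ i, |x i| ≤ 2}
  else adil a ((2 : ℝ) ^ j) '' punctRect n

/-- Partial derivative in the `i`-th coordinate. -/
def pd {n : ℕ} {E : Type*} [NormedAddCommGroup E] [NormedSpace ℝ E] (i : Fin n)
    (f : (Fin n → ℝ) → E) : (Fin n → ℝ) → E :=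
  fun x => deriv (fun t => f (Function.update x i t)) (x i)

/-- Iterated partial derivative `∂^γ` for a multi-index `γ`. -/
def pdm {n : ℕ} {E : Type*} [NormedAddCommGroup E] [NormedSpace ℝ E] (γ : Fin n → ℕ)
    (f : (Fin n → ℝ) → E) : (Fin n → ℝ) → E :=
  (List.finRange n).foldr (fun i g => (pd i)^[γ i] g) f

/-- Fourier transform `f̂(ξ) = ∫ f(x) e^{-i x·ξ} dx`. -/
def FT {n : ℕ} (f : (Fin n → ℝ) → ℂ) (ξ : Fin n → ℝ) : ℂ :=
  ∫ x : Fin n → ℝ, Complex.exp (-(Complex.I) * (∑ i, x i * ξ i)) * f x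

/-- Inverse Fourier transform. -/
def FTinv {n : ℕ} (f : (Fin n → ℝ) → ℂ) (x : Fin n → ℝ) : ℂ :=
  ((2 * Real.pi : ℝ) ^ n : ℝ)⁻¹ •
    ∫ ξ : Fin n → ℝ, Complex.exp (Complex.I * (∑ i, x i * ξ i)) * f ξ

/-- Fourier multiplier operator. -/
def Tm {n : ℕ} (m : (Fin n → ℝ) → ℂ) (f : (Fin n → ℝ) → ℂ) : (Fin n → ℝ) → ℂ :=
  FTinv (fun ξ => m ξ * FT f ξ)

/-- Convolution. -/
def convF {n : ℕ} (f g : (Fin n → ℝ) → ℂ) (x : Fin n → ℝ) : ℂ :=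
  ∫ y : Fin n → ℝ, f y * g (x - y)

/-- Hardy–Littlewood maximal operator in the `k`-th variable. -/
def M1 {n : ℕ} (k : Fin n) (f : (Fin n → ℝ) → ℝ≥0∞) (x : Fin n → ℝ) : ℝ≥0∞ :=
  ⨆ (c : ℝ) (d : ℝ) (_ : c < d) (_ : x k ∈ Set.Icc c d),
    (ENNReal.ofReal (d - c))⁻¹ * ∫⁻ t in Set.Icc c d, f (Function.update x k t)

/-- Iterated maximal operator `𝓜_{r⃗}`. -/
def MIt {n : ℕ} (r : Fin n → ℝ) (f : (Fin n → ℝ) → ℝ≥0∞) : (Fin n → ℝ) → ℝ≥0∞ :=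
  (List.finRange n).foldl
    (fun g k => fun x => (M1 k (fun y => (g y) ^ (r k)) x) ^ (1 / r k)) f

/-- `μ_k = min (p 0, …, p k)`. -/
def muv {n : ℕ} (p : Fin n → ℝ) (k : Fin n) : ℝ :=
  (Finset.Iic k).inf' ⟨k, Finset.mem_Iic.2 le_rfl⟩ p

/-- Admissible exponent vector: `1 ≤ tₙ ≤ … ≤ t₁ ≤ 2`. -/
def Admissible {n : ℕ} (t : Fin n → ℝ) : Prop :=
  (∀ k, 1 ≤ t k ∧ t k ≤ 2) ∧ ∀ k l : Fin n, k ≤ l → t l ≤ t k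

/-- The Hörmander-type mixed-norm multiplier condition `m ∈ 𝓐(α, t⃗, N)`. -/
def Acond {n : ℕ} (a : Fin n → ℝ) (α : ℝ) (t : Fin n → ℝ) (N : ℕ)
    (m : (Fin n → ℝ) → ℂ) : Prop :=
  ∃ C : ℝ≥0∞, C ≠ ∞ ∧ ∀ γ : Fin n → ℕ, (∑ i, γ i) ≤ N → ∀ j : ℕ,
    ENNReal.ofReal ((2 : ℝ) ^ (-(j : ℝ) * α) * (2 : ℝ) ^ ((j : ℝ) * ∑ i, a i * γ i) *
        (2 : ℝ) ^ (-(j : ℝ) * ∑ i, a i / t i)) *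
      mixedNormOn (fun i => ENNReal.ofReal (t i)) (Rset a j) (pdm γ m) ≤ C

/-- `ℓ^q` norm of a sequence, `q ∈ (0,∞]`. -/
def lqSeq (q : ℝ≥0∞) (u : ℕ → ℝ≥0∞) : ℝ≥0∞ :=
  if q = ∞ then ⨆ j, u j else (∑' j, (u j) ^ q.toReal) ^ (1 / q.toReal)

/-- The Littlewood–Paley family `φ_j`, `φ_j(x) = 2^{νj} φ(2^{ja⃗}x)` for `j ≥ 1`. -/
def phifam {n : ℕ} (a : Fin n → ℝ) (φ₀ φ : (Fin n → ℝ) → ℂ) : ℕ → (Fin n → ℝ) → ℂ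
  | 0 => φ₀
  | (j + 1) => fun x =>
      ((2 : ℝ) ^ ((j + 1 : ℕ) * (∑ i, a i)) : ℝ) • φ (adil a ((2 : ℝ) ^ (j + 1 : ℕ)) x)

/-- Anisotropic mixed-norm Besov quasi-norm of `f`, w.r.t. the family `φfam`. -/
def besovNorm {n : ℕ} (s : ℝ) (p : Fin n → ℝ≥0∞) (q : ℝ≥0∞)
    (φfam : ℕ → (Fin n → ℝ) → ℂ) (f : (Fin n → ℝ) → ℂ) : ℝ≥0∞ :=
  lqSeq q (fun j => ENNReal.ofReal ((2 : ℝ) ^ ((j : ℝ) * s)) * mixedNormC p (convF (φfam j) f))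

/-- The anisotropic bracket `⟨x⟩ = |(1,x)|_{(1,a⃗)}`. -/
def abrack {n : ℕ} (a : Fin n → ℝ) (x : Fin n → ℝ) : ℝ :=
  anorm (Fin.cons 1 a) (Fin.cons 1 x)

end

theorem schwartz_norm_sub_le (Φ : 𝓢(ℝ, ℂ)) {N : ℝ} (hN : 0 ≤ N) :
    ∃ K : ℝ, 0 < K ∧ ∀ s s' : ℝ, |s - s'| ≤ 1 →
      ‖Φ s - Φ s'‖ ≤ K * |s - s'| * (1 + |s|) ^ (-N) := by
  obtain ⟨m, hm⟩ := exists_nat_ge N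
  set C := (2 : ℝ) ^ m * ((Finset.Iic (m, 0)).sup
    fun p => SchwartzMap.seminorm ℝ p.1 p.2) (SchwartzMap.derivCLM ℝ ℂ Φ) with hC
  have hderiv : ∀ ξ, (1 + |ξ|) ^ m * ‖deriv Φ ξ‖ ≤ C := fun ξ => by
    have := SchwartzMap.one_add_le_sup_seminorm_apply (𝕜 := ℝ) (m := (m, 0)) le_rfl le_rfl
      (SchwartzMap.derivCLM ℝ ℂ Φ) ξ
    simpa [SchwartzMap.derivCLM_apply] using this
  have hC0 : 0 ≤ C := le_trans (by positivity) (hderiv 0)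
  refine ⟨2 ^ N * (C + 1), by positivity, fun s s' hs => ?_⟩
  have key := Convex.norm_image_sub_le_of_norm_deriv_le (𝕜 := ℝ) (f := Φ)
    (s := Metric.closedBall s 1) (x := s') (y := s) (C := 2 ^ N * (C + 1) * (1 + |s|) ^ (-N))
    (fun x _ => Φ.differentiableAt) ?_ (convex_closedBall _ _)
    (by simpa [Real.dist_eq, abs_sub_comm] using hs) (by simp)
  · refine key.trans_eq ?_
    rw [Real.norm_eq_abs]; ring
  intro ξ hξ
  have hξ' : |ξ - s| ≤ 1 := by simpa [Real.dist_eq] using hξ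
  have h1 : 1 + |s| ≤ 2 * (1 + |ξ|) := by
    have := abs_sub_abs_le_abs_sub s ξ
    rw [abs_sub_comm] at this
    linarith [abs_nonneg ξ]
  have h2 : (1 + |s|) ^ N ≤ 2 ^ N * (1 + |ξ|) ^ m := by
    calc (1 + |s|) ^ N ≤ (2 * (1 + |ξ|)) ^ N := by gcongr
      _ = 2 ^ N * (1 + |ξ|) ^ N := Real.mul_rpow (by positivity) (by positivity)
      _ ≤ 2 ^ N * (1 + |ξ|) ^ m := by
        gcongr
        rw [← Real.rpow_natCast]
        exact Real.rpow_le_rpow_of_exponent_le (by linarith [abs_nonneg ξ]) hm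
  rw [Real.rpow_neg (by positivity), ← div_eq_mul_inv, le_div_iff₀ (by positivity)]
  calc ‖deriv Φ ξ‖ * (1 + |s|) ^ N ≤ ‖deriv Φ ξ‖ * (2 ^ N * (1 + |ξ|) ^ m) := by gcongr
    _ = 2 ^ N * ((1 + |ξ|) ^ m * ‖deriv Φ ξ‖) := by ring
    _ ≤ 2 ^ N * (C + 1) := by gcongr; linarith [hderiv ξ]

theorem norm_sub_le_of_eq_convolution (Φ : 𝓢(ℝ, ℂ)) {a : ℝ} (ha : 0 ≤ a) :
    ∃ K : ℝ, 0 < K ∧ ∀ G : ℝ → ℂ, Continuous G → (∃ C : ℝ, ∀ x, ‖G x‖ ≤ C) →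
      (∀ v, G v = ∫ t, Φ t * G (v - t)) → ∀ S X : ℝ, (∀ Z, ‖G (X - Z)‖ ≤ S * (1 + |Z|) ^ a) →
      ∀ Z u : ℝ, |u| ≤ 1 → ‖G (X - Z) - G (X - Z - u)‖ ≤ K * |u| * (S * (1 + |Z|) ^ a) := by
  obtain ⟨K, hK, hΦ⟩ := schwartz_norm_sub_le Φ (N := a + 2) (by positivity)
  have hint : Integrable (fun s : ℝ => (1 + |s|) ^ (-2 : ℝ)) := by
    simpa using integrable_one_add_norm (E := ℝ) (μ := volume) (r := 2) (by simp)
  set I := ∫ s : ℝ, (1 + |s|) ^ (-2 : ℝ) with hI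
  have hI0 : 0 ≤ I := integral_nonneg fun s => by positivity
  refine ⟨K * (I + 1), by positivity, fun G hG ⟨C, hC⟩ hrep S X hS Z u hu => ?_⟩
  have hS0 : 0 ≤ S := by simpa using (norm_nonneg _).trans (hS 0)
  have hrep' : ∀ v, G v = ∫ s, Φ (v - s) * G s := fun v => by
    rw [hrep v, ← integral_sub_left_eq_self _ _ v]
    simp
  have hI' : ∀ v, Integrable fun s => Φ (v - s) * G s := fun v =>
    (Φ.integrable.comp_sub_left v).mul_bdd (c := C) hG.aestronglyMeasurable (.of_forall hC)
  rw [hrep' (X - Z), hrep' (X - Z - u), ← integral_sub (hI' _) (hI' _)]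
  set v := X - Z with hv
  calc _ ≤ ∫ s, K * |u| * (S * (1 + |Z|) ^ a) * (1 + |v - s|) ^ (-2 : ℝ) := by
        refine norm_integral_le_of_norm_le ((hint.comp_sub_left v).const_mul _)
          (.of_forall fun s => ?_)
        rw [← sub_mul, norm_mul]
        have h1 := hΦ (v - s) (v - u - s) (by simpa using hu)
        have h2 := hS (X - s)
        have h3 : 1 + |X - s| ≤ (1 + |Z|) * (1 + |v - s|) := by
          have : |X - s| ≤ |Z| + |v - s| := by
            have := abs_add_le Z (v - s)
            rwa [show Z + (v - s) = X - s by rw [hv]; ring] at this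
          nlinarith [mul_nonneg (abs_nonneg Z) (abs_nonneg (v - s))]
        have h4 : (1 + |X - s|) ^ a ≤ (1 + |Z|) ^ a * (1 + |v - s|) ^ a := by
          rw [← Real.mul_rpow (by positivity) (by positivity)]
          gcongr
        have h5 : (1 + |v - s|) ^ (-(a + 2)) * (1 + |v - s|) ^ a = (1 + |v - s|) ^ (-2 : ℝ) := by
          rw [← Real.rpow_add (by positivity)]; congr 1; ring
        rw [sub_sub_cancel] at h2
        rw [show v - s - (v - u - s) = u by ring] at h1
        calc _ ≤ (K * |u| * (1 + |v - s|) ^ (-(a + 2))) *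
              (S * ((1 + |Z|) ^ a * (1 + |v - s|) ^ a)) := by gcongr; exact h2.trans (by gcongr)
          _ = K * |u| * (S * (1 + |Z|) ^ a) *
              ((1 + |v - s|) ^ (-(a + 2)) * (1 + |v - s|) ^ a) := by ring
          _ = _ := by rw [h5]
    _ = K * |u| * (S * (1 + |Z|) ^ a) * I := by
        rw [integral_const_mul, integral_sub_left_eq_self (fun s : ℝ => (1 + |s|) ^ (-2 : ℝ))]
    _ ≤ K * |u| * (S * (1 + |Z|) ^ a) * (I + 1) := by gcongr; linarith
    _ = _ := by ring

theorem exists_near_maximizer (Φ : 𝓢(ℝ, ℂ)) {a : ℝ} (ha : 0 ≤ a) :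
    ∃ δ : ℝ, 0 < δ ∧ δ ≤ 1 ∧ ∀ G : ℝ → ℂ, Continuous G → (∃ C : ℝ, ∀ x, ‖G x‖ ≤ C) →
      (∀ v, G v = ∫ t, Φ t * G (v - t)) → ∀ X : ℝ, ∃ Z, ∀ Z' u : ℝ, |u| ≤ δ →
      ‖G (X - Z')‖ * (1 + |Z|) ^ a ≤ 4 * (1 + |Z'|) ^ a * ‖G (X - Z - u)‖ := by
  obtain ⟨K, hK, hlip⟩ := norm_sub_le_of_eq_convolution Φ ha
  refine ⟨min 1 (1 / (4 * K)), by positivity, min_le_left _ _,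
    fun G hG ⟨C, hC⟩ hrep X => ?_⟩
  set φ : ℝ → ℝ := fun Z => ‖G (X - Z)‖ / (1 + |Z|) ^ a with hφ
  have hbdd : BddAbove (range φ) := ⟨C, by
    rintro _ ⟨Z, rfl⟩
    exact (div_le_self (norm_nonneg _)
      (Real.one_le_rpow (by linarith [abs_nonneg Z]) ha)).trans (hC _)⟩
  set S := sSup (range φ) with hSdef
  have hS : ∀ Z, ‖G (X - Z)‖ ≤ S * (1 + |Z|) ^ a := fun Z => by
    rw [← div_le_iff₀ (by positivity)]
    exact le_csSup hbdd ⟨Z, rfl⟩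
  have hS0 : 0 ≤ S := by simpa using (norm_nonneg _).trans (hS 0)
  rcases hS0.eq_or_lt with h0 | hpos
  · refine ⟨0, fun Z' u _ => ?_⟩
    have : ‖G (X - Z')‖ = 0 := le_antisymm (by simpa [← h0] using hS Z') (norm_nonneg _)
    rw [this, zero_mul]; positivity
  obtain ⟨_, ⟨Z, rfl⟩, hZ⟩ := exists_lt_of_lt_csSup (range_nonempty φ) (half_lt_self hpos)
  refine ⟨Z, fun Z' u hu => ?_⟩
  have hZ2 : S / 2 * (1 + |Z|) ^ a < ‖G (X - Z)‖ := by
    rwa [← lt_div_iff₀ (by positivity)]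
  have h1 := hlip G hG ⟨C, hC⟩ hrep S X hS Z u (hu.trans (min_le_left _ _))
  have h2 : K * |u| ≤ 1 / 4 := by
    have := hu.trans (min_le_right _ _)
    calc K * |u| ≤ K * (1 / (4 * K)) := by gcongr
      _ = 1 / 4 := by field_simp
  have h3 : K * |u| * (S * (1 + |Z|) ^ a) ≤ 1 / 4 * (S * (1 + |Z|) ^ a) := by gcongr
  have h4 : S * (1 + |Z|) ^ a ≤ 4 * ‖G (X - Z - u)‖ := by
    have := norm_sub_norm_le (G (X - Z)) (G (X - Z - u))
    linarith
  calc _ ≤ S * (1 + |Z'|) ^ a * (1 + |Z|) ^ a := by gcongr; exact hS Z'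
    _ = (1 + |Z'|) ^ a * (S * (1 + |Z|) ^ a) := by ring
    _ ≤ (1 + |Z'|) ^ a * (4 * ‖G (X - Z - u)‖) := by gcongr
    _ = _ := by ring

theorem exists_average_ge (Φ : 𝓢(ℝ, ℂ)) {r : ℝ} (hr : 0 < r) :
    ∃ c : ℝ≥0∞, c ≠ ∞ ∧ ∀ b : ℝ, 0 < b → ∀ g : ℝ → ℂ, Continuous g → (∃ C : ℝ, ∀ x, ‖g x‖ ≤ C) →
      (∀ v, g v = ∫ t, Φ t * g (v - t / b)) → ∀ x y : ℝ, ∃ p q : ℝ, p < q ∧ x ∈ Icc p q ∧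
        (‖g y‖₊ : ℝ≥0∞) ^ r ≤ c * ENNReal.ofReal (1 + |b * (x - y)|) *
          ((ENNReal.ofReal (q - p))⁻¹ * ∫⁻ t in Icc p q, (‖g t‖₊ : ℝ≥0∞) ^ r) := by
  obtain ⟨δ, hδ, hδ1, hmax⟩ := exists_near_maximizer Φ (a := 1 / r) (by positivity)
  refine ⟨ENNReal.ofReal (4 ^ r / δ), ENNReal.ofReal_ne_top,
    fun b hb g hg ⟨C, hC⟩ hrep x y => ?_⟩
  obtain ⟨Z, hZ⟩ := hmax (fun s => g (s / b)) (by fun_prop) ⟨C, fun s => hC _⟩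
    (fun v => by rw [hrep]; simp only [sub_div]) (b * x)
  set z := Z / b with hz
  have hZb : |Z| = b * |z| := by rw [hz, abs_div, abs_of_pos hb]; field_simp
  set D := 1 + |b * (x - y)| with hD
  have hD0 : 0 < D := by positivity
  set A := ‖g y‖ ^ r * (1 + b * |z|) / (4 ^ r * D) with hA
  have hA0 : 0 ≤ A := by positivity
  have hlow : ∀ w ∈ Icc (x - z - δ / b) (x - z + δ / b), A ≤ ‖g w‖ ^ r := by
    intro w hw
    have hu : |b * (x - z - w)| ≤ δ := by
      rw [abs_mul, abs_of_pos hb, mul_comm, ← le_div_iff₀ hb, abs_le]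
      constructor <;> linarith [hw.1, hw.2]
    have h := hZ (b * (x - y)) _ hu
    have e1 : (b * x - b * (x - y)) / b = y := by field_simp; ring
    have e2 : (b * x - Z - b * (x - z - w)) / b = w := by rw [hz]; field_simp; ring
    simp only [e1, e2] at h
    rw [hA, div_le_iff₀ (by positivity)]
    have h' := Real.rpow_le_rpow (by positivity) h hr.le
    rw [Real.mul_rpow (by positivity) (by positivity), Real.mul_rpow (by positivity) (by positivity),
      Real.mul_rpow (by positivity) (by positivity), ← Real.rpow_mul (by positivity),
      ← Real.rpow_mul (by positivity), one_div_mul_cancel hr.ne', Real.rpow_one, Real.rpow_one,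
      hZb] at h'
    linarith
  have hδb : 0 < δ / b := by positivity
  have hlen : 0 < |z| + δ / b := by positivity
  refine ⟨x - |z| - δ / b, x + |z| + δ / b, by linarith [abs_nonneg z],
    ⟨by linarith [abs_nonneg z], by linarith [abs_nonneg z]⟩, ?_⟩
  have hcast : ∀ w, (‖g w‖₊ : ℝ≥0∞) ^ r = ENNReal.ofReal (‖g w‖ ^ r) := fun w => by
    rw [← ENNReal.ofReal_rpow_of_nonneg (norm_nonneg _) hr.le, ofReal_norm]; rfl
  have hint : ENNReal.ofReal (A * (2 * (δ / b))) ≤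
      ∫⁻ t in Icc (x - |z| - δ / b) (x + |z| + δ / b), (‖g t‖₊ : ℝ≥0∞) ^ r := by
    calc ENNReal.ofReal (A * (2 * (δ / b)))
        = ∫⁻ t in Icc (x - z - δ / b) (x - z + δ / b), ENNReal.ofReal A := by
          rw [setLIntegral_const, Real.volume_Icc, ← ENNReal.ofReal_mul hA0]
          congr 2; ring
      _ ≤ ∫⁻ t in Icc (x - z - δ / b) (x - z + δ / b), (‖g t‖₊ : ℝ≥0∞) ^ r := by
          refine setLIntegral_mono' measurableSet_Icc fun w hw => ?_
          rw [hcast]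
          exact ENNReal.ofReal_le_ofReal (hlow w hw)
      _ ≤ _ := lintegral_mono_set (Icc_subset_Icc (by linarith [le_abs_self z])
          (by linarith [neg_abs_le z]))
  rw [hcast]
  have hreal : ‖g y‖ ^ r ≤ 4 ^ r / δ * D * ((2 * (|z| + δ / b))⁻¹ * (A * (2 * (δ / b)))) := by
    have e : 4 ^ r / δ * D * ((2 * (|z| + δ / b))⁻¹ * (A * (2 * (δ / b)))) =
        ‖g y‖ ^ r * ((1 + b * |z|) / (b * |z| + δ)) := by
      rw [hA]; field_simp
    rw [e]
    refine le_mul_of_one_le_right (by positivity) ?_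
    rw [one_le_div (by positivity)]
    linarith
  calc ENNReal.ofReal (‖g y‖ ^ r)
      ≤ ENNReal.ofReal (4 ^ r / δ * D * ((2 * (|z| + δ / b))⁻¹ * (A * (2 * (δ / b))))) :=
        ENNReal.ofReal_le_ofReal hreal
    _ = ENNReal.ofReal (4 ^ r / δ) * ENNReal.ofReal D *
        ((ENNReal.ofReal (2 * (|z| + δ / b)))⁻¹ * ENNReal.ofReal (A * (2 * (δ / b)))) := by
        rw [ENNReal.ofReal_mul (by positivity), ENNReal.ofReal_mul (by positivity),
          ENNReal.ofReal_mul (p := (2 * (|z| + δ / b))⁻¹) (by positivity),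
          ENNReal.ofReal_inv_of_pos (by positivity)]
    _ ≤ _ := by
        rw [show x + |z| + δ / b - (x - |z| - δ / b) = 2 * (|z| + δ / b) by ring]
        gcongr

theorem foldl_maximal_bound (Φ : 𝓢(ℝ, ℂ)) {n : ℕ} (r : Fin n → ℝ) (hr : ∀ k, 0 < r k)
    (l : List (Fin n)) : l.Nodup →
    ∃ c : ℝ≥0∞, c ≠ ∞ ∧ ∀ b : Fin n → ℝ, (∀ k, 0 < b k) → ∀ f : (Fin n → ℝ) → ℂ,
      Continuous f → (∃ C : ℝ, ∀ x, ‖f x‖ ≤ C) →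
      (∀ k x, f x = ∫ t, Φ t * f (Function.update x k (x k - t / b k))) →
      ∀ x y : Fin n → ℝ, (∀ k ∉ l, x k = y k) →
        (‖f y‖₊ : ℝ≥0∞) ≤
          c * ENNReal.ofReal (l.map fun k => (1 + |b k * (x k - y k)|) ^ (1 / r k)).prod *
            l.foldl (fun g k => fun x => (M1 k (fun y => (g y) ^ (r k)) x) ^ (1 / r k))
              (fun y => (‖f y‖₊ : ℝ≥0∞)) x := by
  induction l using List.reverseRecOn with
  | nil =>
    refine fun _ => ⟨1, by simp, fun b _ f _ _ _ x y hxy => ?_⟩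
    have : x = y := funext fun k => hxy k (by simp)
    simp [this]
  | append_singleton l k ih =>
    intro hnd
    rw [List.nodup_append] at hnd
    have hk : k ∉ l := fun h => hnd.2.2 k h k (by simp) rfl
    obtain ⟨c₀, hc₀, hl⟩ := ih hnd.1
    obtain ⟨c₁, hc₁, hk1⟩ := exists_average_ge Φ (hr k)
    refine ⟨c₀ * c₁ ^ (1 / r k),
      ENNReal.mul_ne_top hc₀ (ENNReal.rpow_ne_top_of_nonneg (by have := hr k; positivity) hc₁),
      fun b hb f hf ⟨C, hC⟩ hrep x y hxy => ?_⟩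
    have hrk := hr k
    set P := (l.map fun k => (1 + |b k * (x k - y k)|) ^ (1 / r k)).prod with hP
    have hP0 : 0 ≤ P := List.prod_nonneg fun a ha => by
      obtain ⟨j, _, rfl⟩ := List.mem_map.1 ha; positivity
    set F := l.foldl (fun g k => fun x => (M1 k (fun y => (g y) ^ (r k)) x) ^ (1 / r k))
              (fun y => (‖f y‖₊ : ℝ≥0∞)) with hF
    obtain ⟨p, q, hpq, hx, hb1⟩ := hk1 (b k) (hb k) (fun t => f (Function.update y k t))
      (hf.comp (continuous_const.update k continuous_id)) ⟨C, fun t => hC _⟩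
      (fun v => by rw [hrep k]; simp) (x k) (y k)
    have hmono : ∀ t, (‖f (Function.update y k t)‖₊ : ℝ≥0∞) ^ r k ≤
        (c₀ * ENNReal.ofReal P) ^ r k * F (Function.update x k t) ^ r k := fun t => by
      rw [← ENNReal.mul_rpow_of_nonneg _ _ hrk.le]
      refine ENNReal.rpow_le_rpow ?_ hrk.le
      refine (hl b hb f hf ⟨C, hC⟩ hrep (Function.update x k t) (Function.update y k t)
        fun j hj => ?_).trans_eq ?_
      · rcases eq_or_ne j k with rfl | hjk
        · simp
        · simpa [hjk] using hxy j (by simp [hj, hjk])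
      · rw [hP]
        congr 4
        refine List.map_congr_left fun j hj => ?_
        have : j ≠ k := fun h => hk (h ▸ hj)
        simp [this]
    have hle : (ENNReal.ofReal (q - p))⁻¹ * ∫⁻ t in Icc p q, F (Function.update x k t) ^ r k ≤
        M1 k (fun y => F y ^ r k) x :=
      le_iSup₂_of_le p q (le_iSup₂_of_le hpq hx le_rfl)
    have hPtop : (c₀ * ENNReal.ofReal P) ^ r k ≠ ∞ :=
      ENNReal.rpow_ne_top_of_nonneg hrk.le (ENNReal.mul_ne_top hc₀ ENNReal.ofReal_ne_top)
    have hmain : (‖f y‖₊ : ℝ≥0∞) ^ r k ≤ c₁ * ENNReal.ofReal (1 + |b k * (x k - y k)|) *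
        ((c₀ * ENNReal.ofReal P) ^ r k * M1 k (fun y => F y ^ r k) x) := by
      simp only [Function.update_eq_self] at hb1
      refine hb1.trans (mul_le_mul' le_rfl ?_)
      calc _ ≤ (ENNReal.ofReal (q - p))⁻¹ *
            ∫⁻ t in Icc p q, (c₀ * ENNReal.ofReal P) ^ r k * F (Function.update x k t) ^ r k := by
            gcongr with t; exact hmono t
        _ = (c₀ * ENNReal.ofReal P) ^ r k *
            ((ENNReal.ofReal (q - p))⁻¹ * ∫⁻ t in Icc p q, F (Function.update x k t) ^ r k) := by
            rw [lintegral_const_mul' _ _ hPtop]; ring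
        _ ≤ _ := by gcongr
    have := ENNReal.rpow_le_rpow hmain (show 0 ≤ 1 / r k by positivity)
    rw [← ENNReal.rpow_mul, mul_one_div_cancel hrk.ne', ENNReal.rpow_one,
      ENNReal.mul_rpow_of_nonneg _ _ (by positivity), ENNReal.mul_rpow_of_nonneg _ _ (by positivity),
      ENNReal.mul_rpow_of_nonneg _ _ (by positivity), ← ENNReal.rpow_mul,
      mul_one_div_cancel hrk.ne', ENNReal.rpow_one,
      ENNReal.ofReal_rpow_of_nonneg (by positivity) (by positivity)] at this
    refine this.trans_eq ?_
    rw [List.foldl_append, List.map_append, List.prod_append, List.map_singleton,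
      List.prod_singleton, ENNReal.ofReal_mul hP0, List.foldl_cons, List.foldl_nil]
    ring

open FourierTransform in
theorem exists_schwartz_fourier_eq_one_near_zero : ∃ Φ χ : 𝓢(ℝ, ℂ), (∀ u : ℝ, |u| ≤ 1 → χ u = 1) ∧
    ∀ u : ℝ, χ u = ∫ t : ℝ, Complex.exp (-Complex.I * ((2 * π * (t * u) : ℝ) : ℂ)) * Φ t := by
  let B : ContDiffBump (0 : ℝ) := ⟨1, 2, one_pos, one_lt_two⟩
  have hB : HasCompactSupport fun u : ℝ => (B u : ℂ) :=
    B.hasCompactSupport.comp_left (g := ((↑) : ℝ → ℂ)) (by simp)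
  let χ : 𝓢(ℝ, ℂ) := hB.toSchwartzMap (Complex.ofRealCLM.contDiff.comp B.contDiff)
  refine ⟨𝓕⁻ χ, χ, fun u hu => ?_, fun u => ?_⟩
  · change ((B u : ℝ) : ℂ) = 1
    rw [B.one_of_mem_closedBall (by simpa [B] using hu)]; simp
  · conv_lhs => rw [← FourierTransform.fourier_fourierInv_eq (E := 𝓢(ℝ, ℂ)) (F := 𝓢(ℝ, ℂ)) χ]
    rw [SchwartzMap.fourier_coe, Real.fourier_eq']
    refine integral_congr_ae (.of_forall fun t => ?_)
    simp only [smul_eq_mul, RCLike.inner_apply, conj_trivial]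
    congr 2
    push_cast; ring

theorem FT_eq_integral {n : ℕ} (f : (Fin n → ℝ) → ℂ) (x : Fin n → ℝ) :
    FT f x = ∫ ξ : Fin n → ℝ, Complex.exp (-Complex.I * ((∑ i, x i * ξ i : ℝ) : ℂ)) * f ξ := by
  simp only [FT, mul_comm]

open FourierTransform in
theorem exists_FT_eq {n : ℕ} (φ : 𝓢(Fin n → ℝ, ℂ)) : ∃ η : 𝓢(Fin n → ℝ, ℂ), ∀ x, FT η x = φ x := by
  let e := EuclideanSpace.equiv (Fin n) ℝ
  let η₀ : 𝓢(EuclideanSpace ℝ (Fin n), ℂ) := 𝓕⁻ (SchwartzMap.compCLMOfContinuousLinearEquiv ℂ e φ)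
  have hπ : (2 * π)⁻¹ ≠ 0 := by positivity
  let L : (Fin n → ℝ) ≃L[ℝ] EuclideanSpace ℝ (Fin n) :=
    (ContinuousLinearEquiv.smulLeft (Units.mk0 _ hπ)).trans e.symm
  refine ⟨(((2 * π) ^ n : ℝ) : ℂ)⁻¹ • SchwartzMap.compCLMOfContinuousLinearEquiv ℂ L η₀,
    fun x => ?_⟩
  set h : (Fin n → ℝ) → ℂ := fun u =>
    Complex.exp (-Complex.I * ((2 * π * ∑ i, x i * u i : ℝ) : ℂ)) * η₀ (e.symm u) with hh
  have h1 : FT (⇑((((2 * π) ^ n : ℝ) : ℂ)⁻¹ • SchwartzMap.compCLMOfContinuousLinearEquiv ℂ L η₀)) x =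
      ∫ ξ, (((2 * π) ^ n : ℝ) : ℂ)⁻¹ * h ((2 * π)⁻¹ • ξ) := by
    rw [FT_eq_integral]
    refine integral_congr_ae (.of_forall fun ξ => ?_)
    have : 2 * π * ∑ i, x i * ((2 * π)⁻¹ * ξ i) = ∑ i, x i * ξ i := by
      rw [Finset.mul_sum]
      refine Finset.sum_congr rfl fun i _ => ?_
      field_simp
    simp only [hh, Pi.smul_apply, smul_eq_mul, this]
    rw [mul_left_comm]
    rfl
  have h2 : ∫ u, h u = φ x := by
    rw [← (PiLp.volume_preserving_ofLp (Fin n)).integral_comp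
      (MeasurableEquiv.toLp 2 (Fin n → ℝ)).symm.measurableEmbedding]
    have : φ x = 𝓕 η₀ (e.symm x) := by
      simp [η₀]
    rw [this, SchwartzMap.fourier_coe, Real.fourier_eq']
    refine integral_congr_ae (.of_forall fun t => ?_)
    simp only [hh, smul_eq_mul]
    congr 2
    have : inner ℝ t (e.symm x) = ∑ i, x i * t i := by
      simp [PiLp.inner_apply, e]
    rw [this]; push_cast; ring
  rw [h1, integral_const_mul, Measure.integral_comp_smul, h2]
  simp only [Module.finrank_fintype_fun_eq_card, Fintype.card_fin, inv_pow, inv_inv]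
  rw [abs_of_pos (by positivity), Complex.real_smul, inv_mul_cancel_left₀]
  exact_mod_cast (by positivity)

theorem exists_FT_eq_sub_integral (Φ χ : 𝓢(ℝ, ℂ)) (hχ1 : ∀ u : ℝ, |u| ≤ 1 → χ u = 1)
    (hχ : ∀ u : ℝ, χ u = ∫ t : ℝ, Complex.exp (-Complex.I * ((2 * π * (t * u) : ℝ) : ℂ)) * Φ t)
    {n : ℕ} (k : Fin n) {b : ℝ} (hb : 0 < b) (η : 𝓢(Fin n → ℝ, ℂ)) :
    ∃ ψ : 𝓢(Fin n → ℝ, ℂ), tsupport ⇑ψ ⊆ {ξ | b < |ξ k|} ∧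
      ∀ x, FT ψ x = FT η x - ∫ t, Φ t * FT η (x + Pi.single k (t / b)) := by
  let ℓ : (Fin n → ℝ) →L[ℝ] ℝ := (2 * π * b)⁻¹ • ContinuousLinearMap.proj k
  have hℓ : ∀ ξ, ℓ ξ = (2 * π * b)⁻¹ * ξ k := fun ξ => rfl
  have hχℓ : (fun ξ => χ (ℓ ξ)).HasTemperateGrowth :=
    χ.hasTemperateGrowth.comp ℓ.hasTemperateGrowth
  refine ⟨η - SchwartzMap.smulLeftCLM ℂ (fun ξ => χ (ℓ ξ)) η, ?_, fun x => ?_⟩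
  · have hclosed : IsClosed {ξ : Fin n → ℝ | 2 * π * b ≤ |ξ k|} :=
      isClosed_le continuous_const (by fun_prop)
    refine (closure_minimal (fun ξ hξ => ?_) hclosed).trans fun ξ (hξ : 2 * π * b ≤ |ξ k|) => ?_
    · by_contra hlt
      refine hξ ?_
      have : |ℓ ξ| ≤ 1 := by
        rw [hℓ, abs_mul, abs_of_pos (by positivity), inv_mul_le_one₀ (by positivity)]
        exact (not_le.1 hlt).le
      simp [SchwartzMap.smulLeftCLM_apply_apply hχℓ, hχ1 _ this]
    · have : b < 2 * π * b := by nlinarith [Real.pi_gt_three]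
      exact this.trans_le hξ
  · have hexp : ∀ s : ℝ, ‖Complex.exp (-Complex.I * (s : ℂ))‖ = 1 := fun s => by
      rw [show -Complex.I * (s : ℂ) = ((-s : ℝ) : ℂ) * Complex.I by push_cast; ring]
      exact Complex.norm_exp_ofReal_mul_I _
    have hint : ∀ ζ : 𝓢(Fin n → ℝ, ℂ), Integrable fun ξ : Fin n → ℝ =>
        Complex.exp (-Complex.I * ((∑ i, x i * ξ i : ℝ) : ℂ)) * ζ ξ := fun ζ =>
      ζ.integrable.bdd_mul (c := 1)
        (Continuous.aestronglyMeasurable (by fun_prop)) (.of_forall fun ξ => (hexp _).le)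
    have hsub : FT (⇑(η - SchwartzMap.smulLeftCLM ℂ (fun ξ => χ (ℓ ξ)) η)) x = FT η x -
        ∫ ξ : Fin n → ℝ, Complex.exp (-Complex.I * ((∑ i, x i * ξ i : ℝ) : ℂ)) *
          (SchwartzMap.smulLeftCLM ℂ (fun ξ => χ (ℓ ξ)) η) ξ := by
      simp only [FT_eq_integral]
      rw [← integral_sub (hint η) (hint _)]
      refine integral_congr_ae (.of_forall fun ξ => ?_)
      simp only [sub_apply, mul_sub]
    rw [hsub]
    congr 1
    have hlhs : ∀ ξ : Fin n → ℝ, Complex.exp (-Complex.I * ((∑ i, x i * ξ i : ℝ) : ℂ)) *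
          (SchwartzMap.smulLeftCLM ℂ (fun ξ => χ (ℓ ξ)) η) ξ =
        ∫ t : ℝ, Complex.exp (-Complex.I * ((∑ i, (x + (Pi.single k (t / b) : Fin n → ℝ)) i * ξ i : ℝ) : ℂ)) *
          (η ξ * Φ t) := fun ξ => by
      rw [SchwartzMap.smulLeftCLM_apply_apply hχℓ, hχ, smul_eq_mul, ← integral_mul_const,
        ← integral_const_mul]
      refine integral_congr_ae (.of_forall fun t => ?_)
      have hsum : ∑ i, (x + (Pi.single k (t / b) : Fin n → ℝ)) i * ξ i =
          ∑ i, x i * ξ i + 2 * π * (t * ℓ ξ) := by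
        simp only [Pi.add_apply, add_mul, Finset.sum_add_distrib, Pi.single_apply, ite_mul,
          zero_mul, Finset.sum_ite_eq', Finset.mem_univ, if_true, hℓ]
        field_simp
      simp only [hsum, Complex.ofReal_add, mul_add, Complex.exp_add]
      ring
    simp only [hlhs]
    rw [integral_integral_swap]
    · refine integral_congr_ae (.of_forall fun t => ?_)
      simp only [FT_eq_integral]
      rw [← integral_const_mul]
      refine integral_congr_ae (.of_forall fun ξ => ?_)
      ring
    · refine (η.integrable.mul_prod Φ.integrable).bdd_mul (c := 1) ?_
        (.of_forall fun p => (hexp _).le)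
      refine Continuous.aestronglyMeasurable ?_
      have : Continuous fun p : (Fin n → ℝ) × ℝ =>
          ∑ i, (x + (Pi.single k (p.2 / b) : Fin n → ℝ)) i * p.1 i := by
        refine continuous_finsetSum _ fun i _ => ?_
        simp only [Pi.add_apply, Pi.single_apply]
        split_ifs <;> fun_prop
      fun_prop

theorem eq_convolution_of_spectrum (Φ χ : 𝓢(ℝ, ℂ)) (hχ1 : ∀ u : ℝ, |u| ≤ 1 → χ u = 1)
    (hχ : ∀ u : ℝ, χ u = ∫ t : ℝ, Complex.exp (-Complex.I * ((2 * π * (t * u) : ℝ) : ℂ)) * Φ t)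
    {n : ℕ} (k : Fin n) {b : ℝ} (hb : 0 < b) {f : (Fin n → ℝ) → ℂ} (hf : Continuous f) {C : ℝ}
    (hC : ∀ x, ‖f x‖ ≤ C)
    (hspec : ∀ ψ : 𝓢(Fin n → ℝ, ℂ), tsupport ⇑ψ ⊆ {ξ | b < |ξ k|} →
      ∫ x : Fin n → ℝ, f x * FT ⇑ψ x = 0) (x : Fin n → ℝ) :
    f x = ∫ t, Φ t * f (Function.update x k (x k - t / b)) := by
  have hupd : ∀ (y : Fin n → ℝ) (t : ℝ),
      Function.update y k (y k - t / b) = y - Pi.single k (t / b) := fun y t => by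
    ext i
    rcases eq_or_ne i k with rfl | h
    · simp
    · simp [h]
  simp only [hupd]
  have hsc : Continuous fun t : ℝ => (Pi.single k (t / b) : Fin n → ℝ) :=
    (continuous_single k).comp (by fun_prop)
  have hI : ∀ y : Fin n → ℝ, Integrable fun t => Φ t * f (y - Pi.single k (t / b)) := fun y =>
    Φ.integrable.mul_bdd (c := C) (Continuous.aestronglyMeasurable (by fun_prop)) (
      .of_forall fun t => hC _)
  set h : (Fin n → ℝ) → ℂ := fun y => ∫ t, Φ t * f (y - Pi.single k (t / b)) with hh
  have hhc : Continuous h := by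
    refine continuous_of_dominated (bound := fun t => ‖Φ t‖ * C)
      (fun y => (hI y).aestronglyMeasurable) (fun y => .of_forall fun t => ?_)
      (Φ.integrable.norm.mul_const C) (.of_forall fun t => by fun_prop)
    rw [norm_mul]; gcongr; exact hC _
  have hhb : ∀ y, ‖h y‖ ≤ ∫ t, ‖Φ t‖ * C := fun y =>
    norm_integral_le_of_norm_le (Φ.integrable.norm.mul_const C) (.of_forall fun t => by
      rw [norm_mul]; gcongr; exact hC _)
  have hae : ∀ᵐ y, (f - h) y = 0 := by
    refine ae_eq_zero_of_integral_contDiff_smul_eq_zero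
      (hf.sub hhc).locallyIntegrable fun g hg hgc => ?_
    have hgc' : HasCompactSupport fun u => (g u : ℂ) :=
      hgc.comp_left (g := ((↑) : ℝ → ℂ)) (by simp)
    set φ : 𝓢(Fin n → ℝ, ℂ) := hgc'.toSchwartzMap (Complex.ofRealCLM.contDiff.comp hg) with hφ
    have hφg : ∀ y, φ y = (g y : ℂ) := fun y => rfl
    obtain ⟨η, hη⟩ := exists_FT_eq φ
    obtain ⟨ψ, hψs, hψ⟩ := exists_FT_eq_sub_integral Φ χ hχ1 hχ k hb η
    have h0 := hspec ψ hψs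
    simp only [hψ, hη] at h0
    have hJ : Integrable (fun p : (Fin n → ℝ) × ℝ => Φ p.2 * φ (p.1 + Pi.single k (p.2 / b)))
        (volume.prod volume) := by
      have hcont : Continuous fun p : (Fin n → ℝ) × ℝ =>
          Φ p.2 * φ (p.1 + Pi.single k (p.2 / b)) := by
        have := hsc.comp (continuous_snd (X := Fin n → ℝ) (Y := ℝ))
        exact (Φ.continuous.comp continuous_snd).mul (φ.continuous.comp (continuous_fst.add this))
      rw [integrable_prod_iff' hcont.aestronglyMeasurable]
      refine ⟨.of_forall fun t => (φ.integrable.comp_add_right (Pi.single k (t / b))).const_mul (Φ t),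
        ?_⟩
      simp only [norm_mul, integral_const_mul]
      have : ∀ t : ℝ, ∫ y : Fin n → ℝ, ‖φ (y + Pi.single k (t / b))‖ = ∫ y, ‖φ y‖ :=
        fun t => integral_add_right_eq_self (fun y => ‖φ y‖) _
      simp only [this]
      exact Φ.integrable.norm.mul_const _
    have hJf : Integrable (fun p : (Fin n → ℝ) × ℝ =>
        f p.1 * (Φ p.2 * φ (p.1 + Pi.single k (p.2 / b)))) (volume.prod volume) :=
      hJ.bdd_mul (c := C) (by fun_prop) (.of_forall fun p => hC _)
    have hJ' : Integrable (fun p : ℝ × (Fin n → ℝ) =>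
        f (p.2 - Pi.single k (p.1 / b)) * (Φ p.1 * φ p.2)) (volume.prod volume) := by
      refine (Φ.integrable.mul_prod φ.integrable).bdd_mul (c := C) ?_ (.of_forall fun p => hC _)
      have := hsc.comp (continuous_fst (X := ℝ) (Y := Fin n → ℝ))
      exact (hf.comp (continuous_snd.sub this)).aestronglyMeasurable
    have hswap : ∫ y, f y * ∫ t, Φ t * φ (y + Pi.single k (t / b)) = ∫ y, φ y * h y := by
      simp only [← integral_const_mul]
      rw [integral_integral_swap hJf]
      have : ∀ t : ℝ, ∫ y, f y * (Φ t * φ (y + Pi.single k (t / b))) =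
          ∫ y, f (y - Pi.single k (t / b)) * (Φ t * φ y) := fun t => by
        rw [← integral_add_right_eq_self (fun y => f (y - (Pi.single k (t / b) : Fin n → ℝ)) * (Φ t * φ y))
          (Pi.single k (t / b) : Fin n → ℝ)]
        simp
      simp only [this]
      rw [integral_integral_swap hJ']
      refine integral_congr_ae (.of_forall fun y => ?_)
      simp only [hh, ← integral_const_mul]
      refine integral_congr_ae (.of_forall fun t => ?_)
      ring
    have hfφ : Integrable fun y => f y * φ y :=
      φ.integrable.bdd_mul hf.aestronglyMeasurable (.of_forall hC)
    have hφh : Integrable fun y => φ y * h y :=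
      φ.integrable.mul_bdd hhc.aestronglyMeasurable (.of_forall hhb)
    have hfJ : Integrable fun y => f y * ∫ t, Φ t * φ (y + Pi.single k (t / b)) := by
      simpa only [integral_const_mul] using hJf.integral_prod_left
    simp only [mul_sub] at h0
    rw [integral_sub hfφ hfJ, hswap, ← integral_sub hfφ hφh] at h0
    rw [← h0]
    refine integral_congr_ae (.of_forall fun y => ?_)
    simp only [Pi.sub_apply, Complex.real_smul, hφg]
    ring
  have := (hf.sub hhc).ae_eq_iff_eq volume (continuous_const (y := (0 : ℂ))) |>.1 hae
  exact sub_eq_zero.1 (congrFun this x)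

/-- Peetre-type maximal estimate: for `r⃗ ∈ (0,∞)ⁿ` there is
`c > 0` such that for every `b⃗ ∈ (0,∞)ⁿ` and every bounded continuous `f`
whose (distributional) Fourier transform is supported in
`[-b₁,b₁]×⋯×[-bₙ,bₙ]`, one has
`|f(x−z)| / ∏ (1+|b_k z_k|)^{1/r_k} ≤ c 𝓜_{r⃗} f(x)` for all `x, z`. -/
theorem peetre_maximal_estimate {n : ℕ} (r : Fin n → ℝ) (hr : ∀ k, 0 < r k) :
    ∃ c : ℝ≥0∞, 0 < c ∧ c ≠ ∞ ∧
      ∀ b : Fin n → ℝ, (∀ k, 0 < b k) →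
      ∀ f : (Fin n → ℝ) → ℂ, Continuous f → (∃ C : ℝ, ∀ x, ‖f x‖ ≤ C) →
      (∀ ψ : SchwartzMap (Fin n → ℝ) ℂ,
        tsupport ⇑ψ ⊆ {ξ | ∃ k, b k < |ξ k|} →
          ∫ x : Fin n → ℝ, f x * FT ⇑ψ x = 0) →
      ∀ x z : Fin n → ℝ,
        ENNReal.ofReal (‖f (x - z)‖ / ∏ k, (1 + |b k * z k|) ^ (1 / r k)) ≤
          c * MIt r (fun y => (‖f y‖₊ : ℝ≥0∞)) x := by
  obtain ⟨Φ, χ, hχ1, hχ⟩ := exists_schwartz_fourier_eq_one_near_zero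
  obtain ⟨c, hc, h⟩ := foldl_maximal_bound Φ r hr (List.finRange n) (List.nodup_finRange n)
  refine ⟨c + 1, by positivity, by simpa using hc, fun b hb f hf ⟨C, hC⟩ hspec x z => ?_⟩
  have hbound := h b hb f hf ⟨C, hC⟩ (fun k => eq_convolution_of_spectrum Φ χ hχ1 hχ k (hb k) hf hC
    fun ψ hψ => hspec ψ fun ξ hξ => ⟨k, hψ hξ⟩) x (x - z) fun k hk => absurd (List.mem_finRange k) hk
  simp only [← Fin.prod_univ_def, Pi.sub_apply, sub_sub_cancel] at hbound
  have hP : 0 < ∏ k, (1 + |b k * z k|) ^ (1 / r k) := Finset.prod_pos fun k _ => by positivity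
  rw [ENNReal.ofReal_div_of_pos hP]
  refine ENNReal.div_le_of_le_mul ?_
  rw [ofReal_norm]
  refine hbound.trans ?_
  rw [mul_right_comm]
  gcongr
  · exact le_self_add
  · exact le_rfl
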